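/- arXiv:2509.24535 — 4 statements merged into one kernel-verified Lean document; each statement's English description precedes it below -/
import Mathlib

section
/- Let k : [0,∞) → [0,∞) be a bounded continuous hazard rate and F(y) = 1 − exp(−∫_0^y k(u) du) its cdf, and fix λ > 2e. For the Gamma kernel, for every t ≥ 0 there exist b₀ > 0 and constants G(t) > 0 and B(t) > 0 such that for all 0 < b ≤ min(b₀, 1, 1/(4‖k‖_∞)) and all y ≥ 0 with |y − t| > λ one has κ_{t,b}(y)/(1 − F(y)) ≤ G(t) e^{−B(t)/b}. In particular the Gamma kernel satisfies the strong compatibility Assumption 7 (and hence the compatibility Assumption 3) with γ = 1/2. -/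
open Real Filter Set Asymptotics Topology MeasureTheory

/-- The shape parameter of the Gamma kernel (version without interior bias). -/
noncomputable def gammaRho (t b : ℝ) : ℝ :=
  if 2 * b ≤ t then t / b else t ^ 2 / (4 * b ^ 2) + 1

/-- The Gamma kernel with bandwidth `b` at point `t`, evaluated at `y`. -/
noncomputable def gammaKer (t b y : ℝ) : ℝ :=
  if 0 ≤ y then
    y ^ (gammaRho t b - 1) * Real.exp (-y / b) /
      (b ^ (gammaRho t b) * Real.Gamma (gammaRho t b))
  else 0

/-- The cumulative distribution function associated with a hazard rate `k`:
`F(t) = 1 − exp(−∫_0^t k(u) du)`. -/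
noncomputable def hazCdf (k : ℝ → ℝ) (t : ℝ) : ℝ :=
  1 - Real.exp (-(∫ u in (0 : ℝ)..t, k u))

/-- Cutting Euler's integral at `c` bounds `Γ(s)` from below by `c ^ (s - 1) * e ^ (-c)`. -/
theorem rpow_mul_exp_neg_le_Gamma {s c : ℝ} (hs : 1 ≤ s) (hc : 0 < c) :
    c ^ (s - 1) * Real.exp (-c) ≤ Real.Gamma s := by
  have hint := Real.GammaIntegral_convergent (s := s) (by linarith)
  have hsub : Ioi c ⊆ Ioi (0 : ℝ) := Ioi_subset_Ioi hc.le
  rw [Real.Gamma_eq_integral (by linarith)]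
  calc c ^ (s - 1) * Real.exp (-c) = ∫ x in Ioi c, c ^ (s - 1) * Real.exp (-x) := by
        rw [integral_const_mul, integral_exp_neg_Ioi]
    _ ≤ ∫ x in Ioi c, Real.exp (-x) * x ^ (s - 1) := by
        refine setIntegral_mono_on ((integrableOn_exp_neg_Ioi c).const_mul _)
          (hint.mono_set hsub) measurableSet_Ioi fun x hx => ?_
        rw [mul_comm]
        have : c ≤ x := (mem_Ioi.1 hx).le
        gcongr
    _ ≤ ∫ x in Ioi (0 : ℝ), Real.exp (-x) * x ^ (s - 1) := by
        refine setIntegral_mono_set hint ?_ hsub.eventuallyLE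
        filter_upwards [ae_restrict_mem measurableSet_Ioi] with x hx
        have : 0 < x := hx
        simp only [Pi.zero_apply]
        positivity

theorem one_div_mul_exp_neg_div_le {b c : ℝ} (hb : 0 < b) (hc : 0 < c) :
    1 / b * Real.exp (-c / b) ≤ 2 / c * Real.exp (-(c / 2) / b) := by
  have h : 1 / b ≤ 2 / c * Real.exp (c / 2 / b) := by
    have h1 : c / 2 / b ≤ Real.exp (c / 2 / b) := by linarith [Real.add_one_le_exp (c / 2 / b)]
    calc 1 / b = 2 / c * (c / 2 / b) := by field_simp
      _ ≤ _ := by gcongr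
  calc 1 / b * Real.exp (-c / b)
      ≤ 2 / c * Real.exp (c / 2 / b) * Real.exp (-c / b) := by gcongr
    _ = 2 / c * Real.exp (-(c / 2) / b) := by
        rw [mul_assoc, ← Real.exp_add]
        congr 2
        ring

theorem gammaKer_le {t b y : ℝ} (ht : 0 < t) (hb : 0 < b) (hbt : 2 * b ≤ t) (hy : 0 ≤ y) :
    gammaKer t b y ≤ 1 / b * ((y / t) ^ (t / b - 1) * Real.exp ((t - y) / b)) := by
  have hs : 1 ≤ t / b := by rw [le_div_iff₀ hb]; linarith
  have hG := rpow_mul_exp_neg_le_Gamma hs (div_pos ht hb)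
  have hpos : 0 < (t / b) ^ (t / b - 1) * Real.exp (-(t / b)) := by positivity
  simp only [gammaKer, gammaRho, if_pos hy, if_pos hbt]
  calc y ^ (t / b - 1) * Real.exp (-y / b) / (b ^ (t / b) * Real.Gamma (t / b))
      ≤ y ^ (t / b - 1) * Real.exp (-y / b) /
          (b ^ (t / b) * ((t / b) ^ (t / b - 1) * Real.exp (-(t / b)))) := by gcongr
    _ = _ := by
      rw [Real.div_rpow ht.le hb.le, Real.div_rpow hy ht.le, sub_div, Real.exp_sub,
        Real.exp_neg, neg_div, Real.exp_neg, Real.rpow_sub_one hb.ne']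
      field_simp

/-- Off the point `t`, the function `a ↦ t log (a / t) + t - a` is negative. -/
theorem mul_log_div_lt_sub {t a : ℝ} (ht : 0 < t) (ha : 0 < a) (hat : a ≠ t) :
    t * Real.log (a / t) < a - t := by
  have h := Real.log_lt_sub_one_of_pos (div_pos ha ht) (by rwa [Ne, div_eq_one_iff_eq ht.ne'])
  calc t * Real.log (a / t) < t * (a / t - 1) := by gcongr
    _ = a - t := by field_simp

/-- Exponential smallness of the Gamma kernel at `t > 0`, beyond a point `a ≠ t`. -/
theorem eventually_gammaKer_mul_exp_le (M : ℝ) {t a : ℝ} (ht : 0 < t) (ha : 0 < a)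
    (hat : a ≠ t) :
    ∃ G > 0, ∃ B > 0, ∀ᶠ b in 𝓝[>] (0 : ℝ), ∀ y, 0 ≤ y → 0 ≤ (y - a) * (a - t) →
      gammaKer t b y * Real.exp (M * y) ≤ G * Real.exp (-B / b) := by
  obtain ⟨h, hh⟩ : ∃ h, h = a - t - t * Real.log (a / t) := ⟨_, rfl⟩
  have hpos : 0 < h := by linarith [mul_log_div_lt_sub ht ha hat]
  have hsq : 0 < (a - t) ^ 2 := by have := sub_ne_zero.2 hat; positivity
  have e1 : ∀ᶠ b in 𝓝[>] (0 : ℝ), 2 * b < t :=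
    nhdsWithin_le_nhds <| (Continuous.tendsto' (by fun_prop) _ 0 (by simp)).eventually_lt_const ht
  have e2 : ∀ᶠ b in 𝓝[>] (0 : ℝ), b * (M * a - Real.log (a / t)) < h / 2 :=
    nhdsWithin_le_nhds <| (Continuous.tendsto' (by fun_prop) _ 0 (by simp)).eventually_lt_const
      (half_pos hpos)
  have e3 : ∀ᶠ b in 𝓝[>] (0 : ℝ), b * ((M * a - 1) * (a - t)) < (a - t) ^ 2 :=
    nhdsWithin_le_nhds <| (Continuous.tendsto' (by fun_prop) _ 0 (by simp)).eventually_lt_const hsq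
  refine ⟨2 / (h / 2), by positivity, h / 2 / 2, by positivity, ?_⟩
  filter_upwards [e1, e2, e3, self_mem_nhdsWithin] with b h1 h2 h3 (hb : 0 < b) y hy hya
  have hp : 0 ≤ t / b - 1 := by
    rw [sub_nonneg, le_div_iff₀ hb]; linarith
  have hu : y / t ≤ Real.exp (Real.log (a / t) + (y / a - 1)) := by
    rw [Real.exp_add, Real.exp_log (by positivity)]
    calc y / t = a / t * (y / a) := by field_simp
      _ ≤ _ := by
        gcongr
        linarith [Real.add_one_le_exp (y / a - 1)]
  have hslope : (y - a) * ((t - b) / a - 1 + b * M) ≤ 0 := by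
    have hw : ((t - b) / a - 1 + b * M) * a = t - a + b * (M * a - 1) := by field_simp; ring
    set w := (t - b) / a - 1 + b * M
    have hw' : (w * a) * (a - t) ≤ 0 := by rw [hw]; nlinarith
    have hw2 : w * (a - t) ≤ 0 := by
      by_contra! hc
      nlinarith [mul_pos hc ha]
    have : (y - a) * w * (a - t) ^ 2 ≤ 0 := by nlinarith
    by_contra! hc
    nlinarith [mul_pos hc hsq]
  have hexp : (Real.log (a / t) + (y / a - 1)) * (t / b - 1) + (t - y) / b + M * y
      ≤ -(h / 2) / b := by
    rw [le_div_iff₀ hb]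
    have : ((Real.log (a / t) + (y / a - 1)) * (t / b - 1) + (t - y) / b + M * y) * b
        = -h + b * (M * a - Real.log (a / t)) + (y - a) * ((t - b) / a - 1 + b * M) := by
      rw [hh]; field_simp; ring
    rw [this]
    linarith
  calc gammaKer t b y * Real.exp (M * y)
      ≤ 1 / b * ((y / t) ^ (t / b - 1) * Real.exp ((t - y) / b)) * Real.exp (M * y) := by
        gcongr
        exact gammaKer_le ht hb h1.le hy
    _ ≤ 1 / b * (Real.exp (Real.log (a / t) + (y / a - 1)) ^ (t / b - 1)
          * Real.exp ((t - y) / b)) * Real.exp (M * y) := by gcongr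
    _ = 1 / b * Real.exp ((Real.log (a / t) + (y / a - 1)) * (t / b - 1) + (t - y) / b
          + M * y) := by
        rw [← Real.exp_mul, mul_assoc, ← Real.exp_add, ← Real.exp_add]
    _ ≤ 1 / b * Real.exp (-(h / 2) / b) := by gcongr
    _ ≤ _ := one_div_mul_exp_neg_div_le hb (half_pos hpos)

theorem eventually_gammaKer_zero_mul_exp_le (M : ℝ) {l : ℝ} (hl : 0 < l) :
    ∃ G > 0, ∃ B > 0, ∀ᶠ b in 𝓝[>] (0 : ℝ), ∀ y, l ≤ y →
      gammaKer 0 b y * Real.exp (M * y) ≤ G * Real.exp (-B / b) := by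
  have e1 : ∀ᶠ b in 𝓝[>] (0 : ℝ), M * b < 1 / 2 :=
    nhdsWithin_le_nhds <| (Continuous.tendsto' (by fun_prop) _ 0 (by simp)).eventually_lt_const
      (by norm_num)
  refine ⟨2 / (l / 2), by positivity, l / 2 / 2, by positivity, ?_⟩
  filter_upwards [e1, self_mem_nhdsWithin] with b h1 (hb : 0 < b) y hy
  have hexp : -y / b + M * y ≤ -(l / 2) / b := by
    rw [le_div_iff₀ hb, add_mul, div_mul_cancel₀ _ hb.ne']
    nlinarith
  have hker : gammaKer 0 b y = 1 / b * Real.exp (-y / b) := by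
    have h2 : ¬ 2 * b ≤ 0 := by linarith
    simp only [gammaKer, gammaRho, if_neg h2, if_pos (hl.le.trans hy)]
    simp [div_eq_inv_mul]
  calc gammaKer 0 b y * Real.exp (M * y) = 1 / b * Real.exp (-y / b + M * y) := by
        rw [hker, mul_assoc, ← Real.exp_add]
    _ ≤ 1 / b * Real.exp (-(l / 2) / b) := by gcongr
    _ ≤ _ := one_div_mul_exp_neg_div_le hb (half_pos hl)

theorem eventually_gammaKer_mul_exp_le_of_lt_abs_sub (M : ℝ) {t l : ℝ} (ht : 0 ≤ t)
    (hl : 0 < l) :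
    ∃ G > 0, ∃ B > 0, ∀ᶠ b in 𝓝[>] (0 : ℝ), ∀ y, 0 ≤ y → l < |y - t| →
      gammaKer t b y * Real.exp (M * y) ≤ G * Real.exp (-B / b) := by
  rcases ht.eq_or_lt with rfl | ht
  · obtain ⟨G, hG, B, hB, h⟩ := eventually_gammaKer_zero_mul_exp_le M hl
    refine ⟨G, hG, B, hB, h.mono fun b hb y hy hly => hb y ?_⟩
    rw [sub_zero, abs_of_nonneg hy] at hly
    exact hly.le
  obtain ⟨G, hG, B, hB, h⟩ := eventually_gammaKer_mul_exp_le M ht (a := t + l) (by positivity)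
    (by linarith)
  rcases le_or_gt t l with htl | htl
  · refine ⟨G, hG, B, hB, h.mono fun b hb y hy hly => hb y hy ?_⟩
    rcases lt_abs.1 hly with h' | h' <;> nlinarith
  obtain ⟨G', hG', B', hB', h'⟩ := eventually_gammaKer_mul_exp_le M ht (a := t - l)
    (by linarith) (by linarith)
  refine ⟨max G G', by positivity, min B B', by positivity, ?_⟩
  filter_upwards [h, h', self_mem_nhdsWithin] with b h h' (hb : 0 < b) y hy hly
  rcases lt_abs.1 hly with hc | hc
  · refine (h y hy (by nlinarith)).trans ?_
    gcongr
    · exact le_max_left _ _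
    · exact min_le_left _ _
  · refine (h' y hy (by nlinarith)).trans ?_
    gcongr
    · exact le_max_right _ _
    · exact min_le_right _ _

/-- The Gamma kernel is strongly compatible with the cdf of any bounded continuous hazard
rate: for `λ > 2e` and every `t ≥ 0` there are `b₀ > 0`, `G(t) > 0`, `B(t) > 0` such that
for all `0 < b ≤ min(b₀, 1, 1/(4‖k‖_∞))` and all `y ≥ 0` with `|y−t| > λ`,
`κ_{t,b}(y)/(1−F(y)) ≤ G(t) e^(−B(t)/b)`. -/
theorem gammaKer_strong_compatibility (k : ℝ → ℝ) (hk_cont : Continuous k)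
    (hk_nonneg : ∀ x, 0 ≤ k x)
    (Mk : ℝ) (hMk : Mk = ⨆ x : Ici (0 : ℝ), k x) (hMk_pos : 0 < Mk)
    (hk_bdd : BddAbove (Set.range fun x : Ici (0 : ℝ) => k (x : ℝ)))
    (lambda : ℝ) (hlambda : 2 * Real.exp 1 < lambda) :
    ∀ t : ℝ, 0 ≤ t → ∃ b₀ > (0 : ℝ), ∃ G > (0 : ℝ), ∃ B > (0 : ℝ),
      ∀ b : ℝ, 0 < b → b ≤ min b₀ (min 1 (1 / (4 * Mk))) →
        ∀ y : ℝ, 0 ≤ y → lambda < |y - t| →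
          gammaKer t b y / (1 - hazCdf k y) ≤ G * Real.exp (-B / b) := by
  intro t ht
  have hl : 0 < lambda := by linarith [Real.exp_pos 1]
  obtain ⟨G, hG, B, hB, h⟩ := eventually_gammaKer_mul_exp_le_of_lt_abs_sub Mk ht hl
  obtain ⟨b₀, hb₀, h⟩ := mem_nhdsGT_iff_exists_Ioc_subset.1 h
  refine ⟨b₀, hb₀, G, hG, B, hB, fun b hb hb_le y hy hly => ?_⟩
  refine le_trans ?_ (h ⟨hb, hb_le.trans (min_le_left _ _)⟩ y hy hly)
  have hker : 0 ≤ gammaKer t b y := by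
    have : 0 < gammaRho t b := by
      unfold gammaRho
      split_ifs
      · exact div_pos (by linarith) hb
      · positivity
    have := Real.Gamma_pos_of_pos this
    rw [gammaKer, if_pos hy]
    positivity
  have hint : ∫ u in (0 : ℝ)..y, k u ≤ Mk * y := by
    calc ∫ u in (0 : ℝ)..y, k u ≤ ∫ _ in (0 : ℝ)..y, Mk := by
          refine intervalIntegral.integral_mono_on hy (hk_cont.intervalIntegrable _ _)
            intervalIntegrable_const fun x hx => ?_
          rw [hMk]
          exact le_ciSup hk_bdd ⟨x, hx.1⟩
      _ = Mk * y := by simp [mul_comm]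
  rw [hazCdf, sub_sub_cancel, Real.exp_neg, div_inv_eq_mul]
  gcongr
end

section
/- For the Gamma kernel, for any compact interval I ⊂ [0,∞) there exist constants R₁ > 0 and R₂ > 0 such that for all 0 < b ≤ 1 and all y ≥ 0: ∫_I κ_{t,b}(y) dt ≤ R₁ and ∫_I κ_{t,b}(y)² dt ≤ R₂/b. That is, the Gamma kernel satisfies Assumption 8 with γ = 1/2 and η = 1. -/
open Real Filter Set Asymptotics Topology MeasureTheory

/-- The Poisson probability mass at `n` with rate `z`. -/
noncomputable def poissonWeight (z : ℝ) (n : ℕ) : ℝ := z ^ n / n.factorial * Real.exp (-z)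

lemma poissonWeight_nonneg {z : ℝ} (hz : 0 ≤ z) (n : ℕ) : 0 ≤ poissonWeight z n := by
  unfold poissonWeight; positivity

lemma sum_poissonWeight_le_one {z : ℝ} (hz : 0 ≤ z) (N : ℕ) :
    ∑ n ∈ Finset.range N, poissonWeight z n ≤ 1 := by
  unfold poissonWeight
  rw [← Finset.sum_mul]
  calc _ ≤ Real.exp z * Real.exp (-z) := by
        gcongr; exact Real.sum_le_exp_of_nonneg hz N
    _ = 1 := by rw [← Real.exp_add]; simp

lemma poissonWeight_le_one {z : ℝ} (hz : 0 ≤ z) (n : ℕ) : poissonWeight z n ≤ 1 :=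
  (Finset.single_le_sum (fun i _ => poissonWeight_nonneg hz i)
    (Finset.self_mem_range_succ n)).trans (sum_poissonWeight_le_one hz (n + 1))

lemma factorial_mul_rpow_le_Gamma {n : ℕ} (hn : 1 ≤ n) {s : ℝ} (hs : n ≤ s) :
    (n.factorial : ℝ) * (n : ℝ) ^ (s - n) ≤ Real.Gamma (s + 1) := by
  have hn0 : (0 : ℝ) < n := by exact_mod_cast hn
  rcases hs.eq_or_lt with rfl | hs
  · simp [Real.Gamma_nat_eq_factorial]
  have hx : 0 < s - n := sub_pos.2 hs
  have key := Real.BohrMollerup.f_add_nat_ge Real.convexOn_log_Gamma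
    (fun {y} hy => by
      simp only [Function.comp_apply]
      rw [Real.Gamma_add_one hy.ne', Real.log_mul hy.ne' (Real.Gamma_pos_of_pos hy).ne', add_comm])
    (show 2 ≤ n + 1 by omega) hx
  simp only [Function.comp_apply, Nat.cast_add, Nat.cast_one, add_sub_cancel_right,
    Real.Gamma_nat_eq_factorial] at key
  rw [show (n : ℝ) + 1 + (s - n) = s + 1 by ring] at key
  have hf : (0 : ℝ) < n.factorial := by positivity
  rwa [← Real.log_rpow hn0, ← Real.log_mul hf.ne' (by positivity),
    Real.log_le_log_iff (by positivity) (Real.Gamma_pos_of_pos (by linarith))] at key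

lemma rpow_le_one_add {x r : ℝ} (hx : 0 ≤ x) (hr0 : 0 ≤ r) (hr1 : r ≤ 1) : x ^ r ≤ 1 + x := by
  rcases le_total x 1 with h | h
  · linarith [Real.rpow_le_one hx h hr0]
  · linarith [Real.rpow_le_self_of_one_le h hr1]

lemma rpow_mul_exp_div_Gamma_le_poissonWeight {z s : ℝ} {n : ℕ} (hz : 0 ≤ z) (hn : 1 ≤ n)
    (hs : n ≤ s) (hs' : s ≤ n + 1) :
    z ^ s * Real.exp (-z) / Real.Gamma (s + 1) ≤
      poissonWeight z n + 2 * poissonWeight z (n + 1) := by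
  have hn1 : (1 : ℝ) ≤ n := by exact_mod_cast hn
  have hn0 : (0 : ℝ) < n := by linarith
  have hsplit : z ^ s = z ^ n * ((n : ℝ) ^ (s - n) * (z / n) ^ (s - n)) := by
    rw [← Real.mul_rpow hn0.le (by positivity), mul_div_cancel₀ z hn0.ne', ← Real.rpow_natCast,
      ← Real.rpow_add' hz (by linarith)]
    congr 1; ring
  have hpow : z ^ s ≤ z ^ n * ((n : ℝ) ^ (s - n) * (1 + z / n)) := by
    rw [hsplit]
    gcongr
    exact rpow_le_one_add (by positivity) (by linarith) (by linarith)
  calc z ^ s * Real.exp (-z) / Real.Gamma (s + 1)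
      ≤ z ^ n * ((n : ℝ) ^ (s - n) * (1 + z / n)) * Real.exp (-z) /
          (n.factorial * (n : ℝ) ^ (s - n)) := by
        gcongr
        exact factorial_mul_rpow_le_Gamma hn hs
    _ = poissonWeight z n + (n + 1) / n * poissonWeight z (n + 1) := by
        have : (0 : ℝ) < (n : ℝ) ^ (s - n) := by positivity
        unfold poissonWeight
        rw [Nat.factorial_succ]
        push_cast
        field_simp
        ring
    _ ≤ _ := by
        have := poissonWeight_nonneg hz (n + 1)
        gcongr
        rw [div_le_iff₀ hn0]; linarith

lemma rpow_mul_exp_div_Gamma_le_two {z s : ℝ} (hz : 0 ≤ z) (hs : 0 ≤ s) (hs' : s ≤ 1) :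
    z ^ s * Real.exp (-z) / Real.Gamma (s + 1) ≤ 2 := by
  have hG : 0 < Real.Gamma (s + 1) := Real.Gamma_pos_of_pos (by linarith)
  have h := factorial_mul_rpow_le_Gamma le_rfl (show ((1 : ℕ) : ℝ) ≤ s + 1 by simpa using hs)
  rw [Real.Gamma_add_one (by linarith : s + 1 ≠ 0)] at h
  simp only [Nat.factorial_one, Nat.cast_one, Real.one_rpow, mul_one] at h
  have hnum : z ^ s * Real.exp (-z) ≤ 1 := by
    calc z ^ s * Real.exp (-z) ≤ Real.exp z * Real.exp (-z) := by
          gcongr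
          linarith [rpow_le_one_add hz hs hs', Real.add_one_le_exp z]
      _ = 1 := by rw [← Real.exp_add]; simp
  rw [div_le_iff₀ hG]
  nlinarith

lemma one_le_gammaRho {t b : ℝ} (hb : 0 < b) : 1 ≤ gammaRho t b := by
  unfold gammaRho
  split_ifs with h
  · rw [le_div_iff₀ hb]; linarith
  · have : 0 ≤ t ^ 2 / (4 * b ^ 2) := by positivity
    linarith

lemma gammaKer_eq {t b y : ℝ} (hb : 0 < b) (hy : 0 ≤ y) :
    gammaKer t b y = b⁻¹ * ((y / b) ^ (gammaRho t b - 1) * Real.exp (-(y / b)) /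
      Real.Gamma (gammaRho t b - 1 + 1)) := by
  have hp : b ^ (gammaRho t b) = b ^ (gammaRho t b - 1) * b := by
    rw [← Real.rpow_add_one hb.ne']; simp
  rw [gammaKer, if_pos hy, hp, Real.div_rpow hy hb.le, sub_add_cancel, neg_div]
  have := Real.Gamma_pos_of_pos (zero_lt_one.trans_le (one_le_gammaRho (t := t) hb))
  field_simp

lemma gammaKer_nonneg {t b y : ℝ} (hb : 0 < b) : 0 ≤ gammaKer t b y := by
  unfold gammaKer
  have := Real.Gamma_pos_of_pos (zero_lt_one.trans_le (one_le_gammaRho (t := t) hb))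
  split_ifs <;> positivity

/-- An upper bound for `b * gammaKer t b y` that depends on `z = y / b` and `k = ⌊t / b⌋₊` only. -/
noncomputable def gammaKerStep (z : ℝ) : ℕ → ℝ
  | 0 => 2
  | 1 => 2
  | n + 2 => poissonWeight z (n + 1) + 2 * poissonWeight z (n + 2)

lemma gammaKerStep_nonneg {z : ℝ} (hz : 0 ≤ z) : ∀ k, 0 ≤ gammaKerStep z k
  | 0 => by norm_num [gammaKerStep]
  | 1 => by norm_num [gammaKerStep]
  | n + 2 => by
    have h₁ := poissonWeight_nonneg hz (n + 1)
    have h₂ := poissonWeight_nonneg hz (n + 2)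
    simp only [gammaKerStep]; linarith

lemma gammaKerStep_le_three {z : ℝ} (hz : 0 ≤ z) : ∀ k, gammaKerStep z k ≤ 3
  | 0 => by norm_num [gammaKerStep]
  | 1 => by norm_num [gammaKerStep]
  | n + 2 => by
    have h₁ := poissonWeight_le_one hz (n + 1)
    have h₂ := poissonWeight_le_one hz (n + 2)
    simp only [gammaKerStep]; linarith

lemma sum_gammaKerStep_le {z : ℝ} (hz : 0 ≤ z) (N : ℕ) :
    ∑ k ∈ Finset.range N, gammaKerStep z k ≤ 7 := by
  have h₁ := sum_poissonWeight_le_one hz (N + 1)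
  have h₂ := sum_poissonWeight_le_one hz (N + 2)
  have h₃ := poissonWeight_nonneg hz 0
  have h₄ := poissonWeight_nonneg hz 1
  calc ∑ k ∈ Finset.range N, gammaKerStep z k
      ≤ ∑ k ∈ Finset.range (N + 2), gammaKerStep z k :=
        Finset.sum_le_sum_of_subset_of_nonneg (Finset.range_mono (by omega))
          fun k _ _ => gammaKerStep_nonneg hz k
    _ ≤ 7 := by
        rw [Finset.sum_range_succ'] at h₁
        rw [Finset.sum_range_succ', Finset.sum_range_succ'] at h₂
        rw [Finset.sum_range_succ', Finset.sum_range_succ']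
        simp only [gammaKerStep, Finset.sum_add_distrib, ← Finset.mul_sum, zero_add] at *
        linarith

lemma gammaKer_le_gammaKerStep {t b y : ℝ} (hb : 0 < b) (hy : 0 ≤ y) (ht : 0 ≤ t) :
    gammaKer t b y ≤ b⁻¹ * gammaKerStep (y / b) ⌊t / b⌋₊ := by
  have hz : 0 ≤ y / b := by positivity
  have hu : 0 ≤ t / b := by positivity
  rw [gammaKer_eq hb hy]
  gcongr
  by_cases h : 2 * b ≤ t
  · have h2 : 2 ≤ ⌊t / b⌋₊ := Nat.le_floor (by rw [le_div_iff₀ hb]; exact_mod_cast h)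
    obtain ⟨n, hn⟩ := Nat.exists_eq_add_of_le' h2
    have hlo := Nat.floor_le hu
    have hhi := Nat.lt_floor_add_one (t / b)
    rw [hn] at hlo hhi ⊢
    push_cast at hlo hhi
    rw [gammaRho, if_pos h, gammaKerStep]
    exact rpow_mul_exp_div_Gamma_le_poissonWeight hz (by omega)
      (by push_cast; linarith) (by push_cast; linarith)
  · have hlt : ⌊t / b⌋₊ < 2 := by
      rw [Nat.floor_lt hu, div_lt_iff₀ hb]; exact_mod_cast not_le.1 h
    have hstep : gammaKerStep (y / b) ⌊t / b⌋₊ = 2 := by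
      interval_cases ⌊t / b⌋₊ <;> rfl
    rw [hstep]
    refine rpow_mul_exp_div_Gamma_le_two hz (sub_nonneg.2 (one_le_gammaRho hb)) ?_
    rw [gammaRho, if_neg h, add_sub_cancel_right, div_le_one (by positivity)]
    nlinarith

/-- Integral of the step function `t ↦ a ⌊t / b⌋₊` cut off at `N * b`. -/
lemma integral_sum_indicator_Ico {b : ℝ} (hb : 0 < b) (a : ℕ → ℝ) (N : ℕ) :
    Integrable (fun t : ℝ => ∑ k ∈ Finset.range N,
      (Ico (k * b) ((k + 1) * b)).indicator (fun _ => a k) t) ∧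
    ∫ t : ℝ, ∑ k ∈ Finset.range N, (Ico (k * b) ((k + 1) * b)).indicator (fun _ => a k) t =
      b * ∑ k ∈ Finset.range N, a k := by
  have hint (k : ℕ) : Integrable (fun t : ℝ =>
      (Ico ((k : ℝ) * b) ((k + 1) * b)).indicator (fun _ => a k) t) :=
    (integrable_indicator_iff measurableSet_Ico).2 (integrableOn_const (by simp))
  refine ⟨integrable_finsetSum _ fun k _ => hint k, ?_⟩
  rw [integral_finsetSum _ fun k _ => hint k, Finset.mul_sum]
  refine Finset.sum_congr rfl fun k _ => ?_
  rw [integral_indicator_const _ measurableSet_Ico, Measure.real, Real.volume_Ico,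
    ENNReal.toReal_ofReal (by nlinarith), smul_eq_mul]
  ring

lemma sum_indicator_Ico_eq {b t : ℝ} (hb : 0 < b) (ht : 0 ≤ t) (a : ℕ → ℝ) {N : ℕ}
    (hN : ⌊t / b⌋₊ < N) :
    ∑ k ∈ Finset.range N, (Ico (k * b) ((k + 1) * b)).indicator (fun _ => a k) t =
      a ⌊t / b⌋₊ := by
  have hmem (k : ℕ) : t ∈ Ico (k * b) ((k + 1) * b) ↔ ⌊t / b⌋₊ = k := by
    rw [Nat.floor_eq_iff (by positivity), le_div_iff₀ hb, div_lt_iff₀ hb, mem_Ico]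
  simp [Set.indicator_apply, hmem, hN]

/-- A function dominated by `t ↦ C * a ⌊t / b⌋₊` integrates to at most `C * b * ∑ a`. -/
lemma setIntegral_Icc_le_of_le_floor {b c d C S : ℝ} (hb : 0 < b) (hc : 0 ≤ c) (hC : 0 ≤ C)
    {a : ℕ → ℝ} (ha : ∀ k, 0 ≤ a k) (hS : ∀ N, ∑ k ∈ Finset.range N, a k ≤ S) {f : ℝ → ℝ}
    (hf0 : ∀ t, 0 ≤ f t) (hf : ∀ t, 0 ≤ t → f t ≤ C * a ⌊t / b⌋₊) :
    ∫ t in Icc c d, f t ≤ C * (b * S) := by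
  set N := ⌊d / b⌋₊ + 1
  obtain ⟨hint, hval⟩ := integral_sum_indicator_Ico hb a N
  calc ∫ t in Icc c d, f t
      ≤ ∫ t in Icc c d, C * ∑ k ∈ Finset.range N,
          (Ico (k * b) ((k + 1) * b)).indicator (fun _ => a k) t := by
        refine integral_mono_of_nonneg (ae_of_all _ hf0) (hint.const_mul C).integrableOn ?_
        filter_upwards [ae_restrict_mem measurableSet_Icc] with t ht
        have ht0 := hc.trans ht.1
        rw [sum_indicator_Ico_eq hb ht0 a
          (Nat.lt_succ_of_le (Nat.floor_le_floor (by gcongr; exact ht.2)))]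
        exact hf t ht0
    _ ≤ ∫ t, C * ∑ k ∈ Finset.range N,
          (Ico (k * b) ((k + 1) * b)).indicator (fun _ => a k) t :=
        setIntegral_le_integral (hint.const_mul C) (ae_of_all _ fun t =>
          mul_nonneg hC (Finset.sum_nonneg fun k _ => Set.indicator_nonneg (fun _ _ => ha k) t))
    _ ≤ C * (b * S) := by
        rw [integral_const_mul, hval]
        gcongr
        exact hS N

/-- The Gamma kernel satisfies Assumption 8 with `γ = 1/2` and `η = 1`: for any compact
interval `I = [c,d] ⊂ [0,∞)` there are `R₁, R₂ > 0` such that for all `0 < b ≤ 1` and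
`y ≥ 0`, `∫_I κ_{t,b}(y) dt ≤ R₁` and `∫_I κ_{t,b}(y)² dt ≤ R₂/b`
(note `R₂ b^{-γ(1+η)} = R₂/b` when `γ = 1/2`, `η = 1`). -/
theorem gammaKer_integral_in_t (c d : ℝ) (hc : 0 ≤ c) (hcd : c ≤ d) :
    ∃ R₁ > (0 : ℝ), ∃ R₂ > (0 : ℝ),
      ∀ b : ℝ, 0 < b → b ≤ 1 → ∀ y : ℝ, 0 ≤ y →
        (∫ t in Icc c d, gammaKer t b y) ≤ R₁ ∧
        (∫ t in Icc c d, (gammaKer t b y) ^ 2) ≤ R₂ / b := by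
  refine ⟨7, by norm_num, 21, by norm_num, fun b hb _ y hy => ?_⟩
  have hz : 0 ≤ y / b := by positivity
  constructor
  · refine (setIntegral_Icc_le_of_le_floor hb hc (inv_nonneg.2 hb.le) (gammaKerStep_nonneg hz)
      (sum_gammaKerStep_le hz) (fun _ => gammaKer_nonneg hb)
      fun t ht => gammaKer_le_gammaKerStep hb hy ht).trans_eq ?_
    field_simp
  · refine (setIntegral_Icc_le_of_le_floor (C := b⁻¹ * 3 * b⁻¹) hb hc (by positivity)
      (gammaKerStep_nonneg hz) (sum_gammaKerStep_le hz) (fun _ => sq_nonneg _)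
      fun t ht => ?_).trans_eq ?_
    · have hle := gammaKer_le_gammaKerStep hb hy ht
      have h0 := gammaKer_nonneg (t := t) (y := y) hb
      have hs := gammaKerStep_nonneg hz ⌊t / b⌋₊
      calc gammaKer t b y ^ 2 = gammaKer t b y * gammaKer t b y := sq _
        _ ≤ (b⁻¹ * 3) * (b⁻¹ * gammaKerStep (y / b) ⌊t / b⌋₊) := by
          gcongr
          exact hle.trans (by gcongr; exact gammaKerStep_le_three hz _)
        _ = _ := by ring
    · field_simp
      norm_num
end

section
/- For every p₀ ∈ [0,1): sup_{p ∈ [0,p₀]} | m · Σ_{i=0}^{m−1} C(m,i) p^i (1−p)^{m−i} / (m−i) − 1/(1−p) | → 0 as m → ∞, where C(m,i) denotes the binomial coefficient. Equivalently, for a distribution function F with F(x) < 1 for all x ≥ 0, the quantity m·I_m(y) := m Σ_{i=0}^{m−1} C(m,i) F(y)^i (1−F(y))^{m−i}/(m−i) converges to (1−F(y))^{−1} uniformly in y on any set where F is bounded away from 1, in particular uniformly over y with |y−t| ≤ λ for fixed t and λ. -/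
open Real Filter Set Topology

/-- `I_m(y) = Σ_{i=0}^{m−1} C(m,i) F(y)^i (1−F(y))^{m−i} / (m−i)`. -/
noncomputable def Im (F : ℝ → ℝ) (m : ℕ) (y : ℝ) : ℝ :=
  ∑ i ∈ Finset.range m,
    (m.choose i : ℝ) * F y ^ i * (1 - F y) ^ (m - i) / ((m : ℝ) - i)

/-- The sum `Σ_{i<m} C(m,i) p^i (1-p)^{m-i} / (m-i)`, multiplied by `m`, is within an explicit
distance of `1 / (1 - p)`, uniformly over `p ∈ [0, c]`. -/
lemma abs_mul_binomial_sum_sub_le {c p : ℝ} (hp : 0 ≤ p) (hpc : p ≤ c) (hc : c < 1) (m : ℕ) :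
    |(m : ℝ) * (∑ i ∈ Finset.range m,
        (m.choose i : ℝ) * p ^ i * (1 - p) ^ (m - i) / ((m : ℝ) - i)) - 1 / (1 - p)| ≤
      (3 / (1 - c) ^ 2 + 1 / (1 - c)) * (1 / ((m : ℝ) + 1)) + c ^ m / (1 - c) + m * c ^ m := by
  set q := 1 - p with hq
  set d := 1 - c with hd
  have hd0 : 0 < d := by linarith
  have hdq : d ≤ q := by linarith
  have hq0 : 0 < q := by linarith
  have hm0 : (0 : ℝ) ≤ m := Nat.cast_nonneg m
  have hpq : p + q = 1 := by rw [hq]; ring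
  set S := ∑ i ∈ Finset.range m, (m.choose i : ℝ) * p ^ i * q ^ (m - i) / ((m : ℝ) - i)
  set T := ∑ i ∈ Finset.range m, (m.choose i : ℝ) * p ^ i * q ^ (m - i) / ((m : ℝ) + 1 - i)
    with hT
  set U := ∑ i ∈ Finset.range m, (m.choose i : ℝ) * p ^ i * q ^ (m - i) /
    (((m : ℝ) + 1 - i) * ((m : ℝ) + 2 - i)) with hU
  have hgap : ∀ i ∈ Finset.range m, (1 : ℝ) ≤ m - i := fun i hi => by
    have : i + 1 ≤ m := Finset.mem_range.1 hi
    have : ((i + 1 : ℕ) : ℝ) ≤ m := Nat.cast_le.2 this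
    push_cast at this
    linarith
  have hchoose : ∀ n : ℕ, ∀ i ≤ n,
      (n.choose i : ℝ) * ((n : ℝ) + 1) = ((n + 1).choose i : ℝ) * ((n : ℝ) + 1 - i) := by
    intro n i hi
    have h := Nat.choose_mul_succ_eq n i
    have h' : (((n.choose i) * (n + 1) : ℕ) : ℝ) = (((n + 1).choose i * (n + 1 - i) : ℕ) : ℝ) := by
      rw [h]
    rw [Nat.cast_mul, Nat.cast_mul, Nat.cast_sub (by omega)] at h'
    push_cast at h'
    exact h'
  have hTeq : ((m : ℝ) + 1) * q * T = 1 - p ^ (m + 1) - (m + 1) * p ^ m * q := by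
    have hexp := add_pow p q (m + 1)
    rw [hpq, one_pow, Finset.sum_range_succ, Finset.sum_range_succ] at hexp
    have : ((m : ℝ) + 1) * q * T =
        ∑ i ∈ Finset.range m, p ^ i * q ^ (m + 1 - i) * ((m + 1).choose i : ℝ) := by
      rw [hT, Finset.mul_sum]
      refine Finset.sum_congr rfl fun i hi => ?_
      have h1 := hgap i hi
      have hi' := Finset.mem_range.1 hi
      have h2 := hchoose m i hi'.le
      have h3 : (m : ℝ) + 1 - i ≠ 0 := by linarith
      rw [show m + 1 - i = (m - i) + 1 by omega, pow_succ, mul_div_assoc', div_eq_iff h3]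
      linear_combination q * p ^ i * q ^ (m - i) * h2
    rw [this]
    simp at hexp
    linarith
  have hUle : ((m : ℝ) + 1) * (m + 2) * q ^ 2 * U ≤ 1 := by
    have hexp := add_pow p q (m + 2)
    rw [hpq, one_pow, Finset.sum_range_succ, Finset.sum_range_succ, Finset.sum_range_succ] at hexp
    have : ((m : ℝ) + 1) * (m + 2) * q ^ 2 * U =
        ∑ i ∈ Finset.range m, p ^ i * q ^ (m + 2 - i) * ((m + 2).choose i : ℝ) := by
      rw [hU, Finset.mul_sum]
      refine Finset.sum_congr rfl fun i hi => ?_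
      have h1 := hgap i hi
      have hi' := Finset.mem_range.1 hi
      have h2 := hchoose m i hi'.le
      have h4 := hchoose (m + 1) i (by omega)
      have h3 : ((m : ℝ) + 1 - i) * ((m : ℝ) + 2 - i) ≠ 0 := by
        apply mul_ne_zero <;> linarith
      push_cast at h4
      rw [show m + 2 - i = (m - i) + 2 by omega, pow_add, mul_div_assoc', div_eq_iff h3]
      linear_combination q ^ 2 * p ^ i * q ^ (m - i) * (m + 2) * h2 +
        q ^ 2 * p ^ i * q ^ (m - i) * ((m : ℝ) + 1 - i) * h4
    rw [this]
    have e1 : 0 ≤ p ^ m * q ^ (m + 2 - m) * ((m + 2).choose m : ℝ) := by positivity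
    have e2 : 0 ≤ p ^ (m + 1) * q ^ (m + 2 - (m + 1)) * ((m + 2).choose (m + 1) : ℝ) := by
      positivity
    have e3 : 0 ≤ p ^ (m + 2) * q ^ (m + 2 - (m + 2)) * ((m + 2).choose (m + 2) : ℝ) := by
      positivity
    linarith
  have hTS : T ≤ S := by
    refine Finset.sum_le_sum fun i hi => ?_
    have h1 := hgap i hi
    exact div_le_div_of_nonneg_left (by positivity) (by linarith) (by linarith)
  have hSTU : S ≤ T + 3 * U := by
    rw [hT, hU, Finset.mul_sum, ← Finset.sum_add_distrib]
    refine Finset.sum_le_sum fun i hi => ?_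
    have h1 := hgap i hi
    set k := (m : ℝ) - i with hk
    have ha : 0 ≤ (m.choose i : ℝ) * p ^ i * q ^ (m - i) := by positivity
    rw [show (m : ℝ) + 1 - i = k + 1 by rw [hk]; ring, show (m : ℝ) + 2 - i = k + 2 by rw [hk]; ring]
    have hk1 : 1 / k ≤ 1 / (k + 1) + 3 / ((k + 1) * (k + 2)) := by
      have : 1 / (k + 1) + 3 / ((k + 1) * (k + 2)) = (k + 5) / ((k + 1) * (k + 2)) := by
        field_simp
        ring
      rw [this, div_le_div_iff₀ (by linarith) (by positivity)]
      nlinarith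
    calc _ = (m.choose i : ℝ) * p ^ i * q ^ (m - i) * (1 / k) := by ring
      _ ≤ _ := mul_le_mul_of_nonneg_left hk1 ha
      _ = _ := by ring
  have hpm : p ^ m ≤ c ^ m := pow_le_pow_left₀ hp hpc m
  have hpm0 : 0 ≤ p ^ m := pow_nonneg hp m
  have hqinv : 1 / q ≤ 1 / d := one_div_le_one_div_of_le hd0 hdq
  have hTval : (m : ℝ) * T =
      1 / q - 1 / q * (1 / (m + 1)) - m / (m + 1) * (p ^ (m + 1) / q) - m * p ^ m := by
    have : T = (1 - p ^ (m + 1) - (m + 1) * p ^ m * q) / ((m + 1) * q) := by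
      rw [eq_div_iff (by positivity)]
      linarith
    rw [this]
    field_simp
    ring
  have hfrac : (m : ℝ) / (m + 1) ≤ 1 := (div_le_one (by positivity)).2 (by linarith)
  have hpow : (m : ℝ) / (m + 1) * (p ^ (m + 1) / q) ≤ c ^ m / d := by
    have h1 : p ^ (m + 1) ≤ c ^ m :=
      (pow_le_pow_of_le_one hp (by linarith) (Nat.le_succ m)).trans hpm
    calc _ ≤ 1 * (p ^ (m + 1) / q) := mul_le_mul_of_nonneg_right hfrac (by positivity)
      _ = p ^ (m + 1) / q := one_mul _
      _ ≤ c ^ m / d := div_le_div₀ (hpm0.trans hpm) h1 hd0 hdq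
  have hmul : (m : ℝ) * p ^ m ≤ m * c ^ m := mul_le_mul_of_nonneg_left hpm hm0
  have hinv : 1 / q * (1 / ((m : ℝ) + 1)) ≤ 1 / d * (1 / ((m : ℝ) + 1)) :=
    mul_le_mul_of_nonneg_right hqinv (by positivity)
  have hUb : (m : ℝ) * (3 * U) ≤ 3 / d ^ 2 * (1 / ((m : ℝ) + 1)) := by
    have hU1 : U ≤ 1 / (((m : ℝ) + 1) * (m + 2) * q ^ 2) := by
      rw [le_div_iff₀ (by positivity)]
      linarith
    have hU2 : (m : ℝ) * U ≤ 1 / (((m : ℝ) + 1) * q ^ 2) := by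
      calc _ ≤ (m : ℝ) * (1 / (((m : ℝ) + 1) * (m + 2) * q ^ 2)) :=
            mul_le_mul_of_nonneg_left hU1 hm0
        _ = (m : ℝ) / (m + 2) * (1 / (((m : ℝ) + 1) * q ^ 2)) := by field_simp
        _ ≤ 1 * (1 / (((m : ℝ) + 1) * q ^ 2)) :=
            mul_le_mul_of_nonneg_right ((div_le_one (by positivity)).2 (by linarith))
              (by positivity)
        _ = _ := one_mul _
    have hU3 : 1 / (((m : ℝ) + 1) * q ^ 2) ≤ 1 / (((m : ℝ) + 1) * d ^ 2) := by gcongr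
    calc _ = 3 * ((m : ℝ) * U) := by ring
      _ ≤ 3 * (1 / (((m : ℝ) + 1) * d ^ 2)) := by linarith
      _ = _ := by field_simp
  have hlow : (m : ℝ) * T ≤ m * S := mul_le_mul_of_nonneg_left hTS hm0
  have hupp : (m : ℝ) * S ≤ m * T + m * (3 * U) := by
    rw [← mul_add]
    exact mul_le_mul_of_nonneg_left hSTU hm0
  have n1 : 0 ≤ 1 / d * (1 / ((m : ℝ) + 1)) := by positivity
  have n2 : 0 ≤ 3 / d ^ 2 * (1 / ((m : ℝ) + 1)) := by positivity
  have n3 : 0 ≤ c ^ m / d := div_nonneg (hpm0.trans hpm) hd0.le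
  have n4 : 0 ≤ 1 / q * (1 / ((m : ℝ) + 1)) := by positivity
  have n5 : 0 ≤ (m : ℝ) / (m + 1) * (p ^ (m + 1) / q) := by positivity
  have n6 : 0 ≤ (m : ℝ) * p ^ m := by positivity
  rw [abs_le, add_mul]
  constructor <;> linarith

/-- Uniform convergence of `m Σ_{i<m} C(m,i) p^i (1-p)^{m-i} / (m-i)` to `1 / (1 - p)` along any
family of parameters `p` bounded away from `1`. -/
lemma tendsto_iSup_abs_mul_binomial_sum_sub {ι : Type*} (f : ι → ℝ) {c : ℝ} (hc : c < 1)
    (hf0 : ∀ x, 0 ≤ f x) (hfc : ∀ x, f x ≤ c) :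
    Tendsto
      (fun m : ℕ => ⨆ x, |(m : ℝ) * (∑ i ∈ Finset.range m,
        (m.choose i : ℝ) * f x ^ i * (1 - f x) ^ (m - i) / ((m : ℝ) - i)) - 1 / (1 - f x)|)
      atTop (𝓝 0) := by
  rcases isEmpty_or_nonempty ι with hι | ⟨⟨x₀⟩⟩
  · simp
  have hc0 : 0 ≤ c := (hf0 x₀).trans (hfc x₀)
  have hlim : Tendsto (fun m : ℕ => (3 / (1 - c) ^ 2 + 1 / (1 - c)) * (1 / ((m : ℝ) + 1)) +
      c ^ m / (1 - c) + m * c ^ m) atTop (𝓝 0) := by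
    simpa using ((tendsto_one_div_add_atTop_nhds_zero_nat (𝕜 := ℝ)).const_mul
      (3 / (1 - c) ^ 2 + 1 / (1 - c))).add
      ((tendsto_pow_atTop_nhds_zero_of_lt_one hc0 hc).div_const (1 - c)) |>.add
      (tendsto_self_mul_const_pow_of_lt_one hc0 hc)
  have : Nonempty ι := ⟨x₀⟩
  exact squeeze_zero (fun m => Real.iSup_nonneg fun x => abs_nonneg _)
    (fun m => ciSup_le fun x => abs_mul_binomial_sum_sub_le (hf0 x) (hfc x) hc m) hlim

/-- For every `p₀ ∈ [0,1)`,
`sup_{p ∈ [0,p₀]} |m Σ_{i<m} C(m,i) p^i (1−p)^{m−i}/(m−i) − 1/(1−p)| → 0`; equivalently,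
for a distribution function `F` with `F < 1` everywhere, `m·I_m(y) → (1−F(y))⁻¹`
uniformly on any set where `F` is bounded away from `1`, in particular uniformly over
`{y : |y−t| ≤ λ}` for fixed `t` and `λ`. -/
theorem Im_uniform_convergence :
    (∀ p₀ : ℝ, 0 ≤ p₀ → p₀ < 1 →
      Tendsto
        (fun m : ℕ => ⨆ p : Icc (0 : ℝ) p₀,
          |(m : ℝ) * (∑ i ∈ Finset.range m,
              (m.choose i : ℝ) * (p : ℝ) ^ i * (1 - (p : ℝ)) ^ (m - i) /
                ((m : ℝ) - i)) - 1 / (1 - (p : ℝ))|)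
        atTop (𝓝 0)) ∧
    (∀ F : ℝ → ℝ, Monotone F → (∀ x, 0 ≤ F x) → (∀ x, F x < 1) →
      (∀ A : Set ℝ, (∃ c : ℝ, c < 1 ∧ ∀ y ∈ A, F y ≤ c) →
        Tendsto
          (fun m : ℕ => ⨆ y : A, |(m : ℝ) * Im F m (y : ℝ) - 1 / (1 - F (y : ℝ))|)
          atTop (𝓝 0)) ∧
      (∀ t lambda : ℝ, 0 ≤ lambda →
        Tendsto
          (fun m : ℕ => ⨆ y : {y : ℝ | |y - t| ≤ lambda},
            |(m : ℝ) * Im F m (y : ℝ) - 1 / (1 - F (y : ℝ))|)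
          atTop (𝓝 0))) := by
  refine ⟨fun p₀ _ h1 => tendsto_iSup_abs_mul_binomial_sum_sub
    (fun p : Icc (0 : ℝ) p₀ => (p : ℝ)) h1 (fun p => p.2.1) (fun p => p.2.2),
    fun F hF hF0 hF1 => ⟨?_, fun t lambda _ => ?_⟩⟩
  · rintro A ⟨c, hc, hA⟩
    exact tendsto_iSup_abs_mul_binomial_sum_sub (fun y : A => F y) hc (fun y => hF0 y)
      (fun y => hA y y.2)
  · exact tendsto_iSup_abs_mul_binomial_sum_sub (fun y : {y : ℝ | |y - t| ≤ lambda} => F y)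
      (hF1 (t + lambda)) (fun y => hF0 y)
      (fun y => hF (by linarith [(abs_le.1 (show |(y : ℝ) - t| ≤ lambda from y.2)).2]))
end

section
/- Fix γ > 0 and t ∈ S. Let k be a bounded continuous hazard rate with cdf F, let κ be an associated kernel satisfying Assumptions 3, 5 and 6, and let b_m → 0. Then, with α_b(t) := ∫_S κ_{t,b}(y)² dy: (m/α_{b_m}(t)) · ∫_S ∫_{y ≤ z} [ F(z)^m (1 − F(y)^m) − ((1−F(y))/(F(z)−F(y))) (F(z)^m − F(y)^m) ] κ_{t,b_m}(y) κ_{t,b_m}(z) k(y) k(z) dy dz → 0 as m → ∞. -/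
open Real Filter Set Asymptotics Topology MeasureTheory

/-- The mean shift `Λ(t,b) = E[Z_{t,b}] − t` of an associated kernel on support `S`. -/
noncomputable def lamK (S : Set ℝ) (κ : ℝ → ℝ → ℝ → ℝ) (t b : ℝ) : ℝ :=
  (∫ y in S, y * κ t b y) - t

/-- The variance `Var(Z_{t,b})` of an associated kernel on support `S`. -/
noncomputable def varK (S : Set ℝ) (κ : ℝ → ℝ → ℝ → ℝ) (t b : ℝ) : ℝ :=
  ∫ y in S, (y - ∫ z in S, z * κ t b z) ^ 2 * κ t b y

/-- The covariance bracket is dominated by a mixed geometric sum. -/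
lemma abs_covBracket_le {p q : ℝ} (hp : 0 ≤ p) (hpq : p ≤ q) (hq : q ≤ 1) (m : ℕ) :
    |q ^ m * (1 - p ^ m) - (1 - p) / (q - p) * (q ^ m - p ^ m)| ≤
      (1 - p) * ∑ j ∈ Finset.range m, p ^ j * q ^ (m - 1 - j) := by
  have hq0 : 0 ≤ q := hp.trans hpq
  have hp1 : 0 ≤ 1 - p := by linarith
  have hgeom : 1 - p ^ m = (1 - p) * ∑ j ∈ Finset.range m, p ^ j := (mul_neg_geom_sum p m).symm
  rcases hpq.eq_or_lt with rfl | hlt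
  · rw [sub_self, div_zero, zero_mul, sub_zero, abs_of_nonneg
      (mul_nonneg (pow_nonneg hp m) (sub_nonneg.2 (pow_le_one₀ hp hq))), hgeom, mul_left_comm,
      Finset.mul_sum]
    refine mul_le_mul_of_nonneg_left (Finset.sum_le_sum fun j _ => ?_) hp1
    rw [mul_comm]
    exact mul_le_mul_of_nonneg_left (pow_le_pow_of_le_one hp hq (by omega)) (pow_nonneg hp j)
  · have hne : q - p ≠ 0 := (sub_pos.2 hlt).ne'
    have hdiff : q ^ m - p ^ m =
        (q - p) * ∑ j ∈ Finset.range m, p ^ j * q ^ (m - 1 - j) := by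
      linear_combination (Commute.all p q).geom_sum₂_mul m
    have hexp : q ^ m * (1 - p ^ m) - (1 - p) / (q - p) * (q ^ m - p ^ m) =
        -((1 - p) * ∑ j ∈ Finset.range m, p ^ j * q ^ (m - 1 - j) * (1 - q ^ (j + 1))) := by
      have hsplit : ∑ j ∈ Finset.range m, p ^ j * q ^ (m - 1 - j) * (1 - q ^ (j + 1)) =
          (∑ j ∈ Finset.range m, p ^ j * q ^ (m - 1 - j)) -
            q ^ m * ∑ j ∈ Finset.range m, p ^ j := by
        rw [Finset.mul_sum, ← Finset.sum_sub_distrib]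
        refine Finset.sum_congr rfl fun j hj => ?_
        have hm : q ^ m = q ^ (m - 1 - j) * q ^ (j + 1) := by
          rw [← pow_add]
          congr 1
          have := Finset.mem_range.1 hj
          omega
        rw [hm]
        ring
      rw [hsplit, hdiff, hgeom]
      field_simp
      ring
    have hterm : ∀ j, 0 ≤ 1 - q ^ (j + 1) := fun j => sub_nonneg.2 (pow_le_one₀ hq0 hq)
    rw [hexp, abs_neg, abs_of_nonneg (mul_nonneg hp1 (Finset.sum_nonneg fun j _ =>
      mul_nonneg (by positivity) (hterm j)))]
    refine mul_le_mul_of_nonneg_left (Finset.sum_le_sum fun j _ => ?_) hp1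
    exact mul_le_of_le_one_right (by positivity) (by linarith [pow_nonneg hq0 (j + 1)])

lemma one_sub_mul_sum_nat_mul_pow (p : ℝ) (m : ℕ) :
    (1 - p) * ∑ j ∈ Finset.range m, (j : ℝ) * p ^ j + m * p ^ m =
      p * ∑ j ∈ Finset.range m, p ^ j := by
  induction m with
  | zero => simp
  | succ n ih =>
    rw [Finset.sum_range_succ, Finset.sum_range_succ]
    push_cast
    linear_combination ih

lemma nat_mul_weighted_geom_sum_le {p : ℝ} (hp : 0 ≤ p) (hp1 : p ≤ 1) (m : ℕ) :
    m * ((1 - p) * ∑ j ∈ Finset.range m,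
      p ^ j * ((1 - p ^ (m - 1 - j + 1)) / ((m - 1 - j : ℕ) + 1))) ≤ 2 := by
  have h1 : 0 ≤ 1 - p := by linarith
  have hterm : ∀ j ∈ Finset.range m,
      m * (p ^ j * ((1 - p ^ (m - 1 - j + 1)) / ((m - 1 - j : ℕ) + 1))) ≤
        p ^ j + (1 - p) * (j * p ^ j) := by
    intro j hj
    have hj' := Finset.mem_range.1 hj
    obtain ⟨i, rfl⟩ : ∃ i, m = j + i + 1 := ⟨m - 1 - j, by omega⟩
    have hi : j + i + 1 - 1 - j = i := by omega
    rw [hi]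
    have hpos : (0 : ℝ) < i + 1 := by positivity
    set w := (1 - p ^ (i + 1)) / ((i : ℝ) + 1) with hw
    have hw_mul : ((i : ℝ) + 1) * w = 1 - p ^ (i + 1) := by rw [hw]; field_simp
    have hw_le : w ≤ 1 - p := by
      rw [hw, div_le_iff₀ hpos]
      have := one_add_mul_le_pow (a := p - 1) (by linarith) (i + 1)
      simp only [add_sub_cancel] at this
      push_cast at this
      linarith
    have hpj : 0 ≤ p ^ j := pow_nonneg hp j
    have hpi : 0 ≤ p ^ (i + 1) := pow_nonneg hp _
    have e : ((j + i + 1 : ℕ) : ℝ) * (p ^ j * w) =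
        p ^ j * (1 - p ^ (i + 1)) + w * (j * p ^ j) := by
      push_cast
      linear_combination p ^ j * hw_mul
    rw [e]
    refine add_le_add (mul_le_of_le_one_right hpj (by linarith)) ?_
    exact mul_le_mul_of_nonneg_right hw_le (by positivity)
  have hgeom : (1 - p) * ∑ j ∈ Finset.range m, p ^ j ≤ 1 := by
    rw [mul_neg_geom_sum]
    linarith [pow_nonneg hp m]
  have harith := one_sub_mul_sum_nat_mul_pow p m
  have hsum : (1 - p) * ∑ j ∈ Finset.range m, (j : ℝ) * p ^ j ≤
      ∑ j ∈ Finset.range m, p ^ j := by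
    have h0 : 0 ≤ ∑ j ∈ Finset.range m, p ^ j := Finset.sum_nonneg fun j _ => pow_nonneg hp j
    have : (0 : ℝ) ≤ m * p ^ m := by positivity
    nlinarith
  calc _ = (1 - p) * ∑ j ∈ Finset.range m,
        m * (p ^ j * ((1 - p ^ (m - 1 - j + 1)) / ((m - 1 - j : ℕ) + 1))) := by
        rw [← Finset.mul_sum]; ring
    _ ≤ (1 - p) * ∑ j ∈ Finset.range m, (p ^ j + (1 - p) * (j * p ^ j)) :=
        mul_le_mul_of_nonneg_left (Finset.sum_le_sum hterm) h1
    _ ≤ (1 - p) * (∑ j ∈ Finset.range m, p ^ j + ∑ j ∈ Finset.range m, p ^ j) := by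
        rw [Finset.sum_add_distrib, ← Finset.mul_sum]
        exact mul_le_mul_of_nonneg_left (add_le_add le_rfl hsum) h1
    _ ≤ 2 := by linarith

lemma sum_mixed_pow_le {p q r : ℝ} (hp : 0 ≤ p) (hpq : p ≤ q) (hqr : q ≤ r) (m : ℕ) :
    ∑ j ∈ Finset.range m, p ^ j * q ^ (m - 1 - j) ≤ m * r ^ (m - 1) := by
  have hq : 0 ≤ q := hp.trans hpq
  have hr : 0 ≤ r := hq.trans hqr
  calc _ ≤ ∑ _j ∈ Finset.range m, r ^ (m - 1) := by
        refine Finset.sum_le_sum fun j hj => ?_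
        have hj' := Finset.mem_range.1 hj
        calc p ^ j * q ^ (m - 1 - j) ≤ r ^ j * r ^ (m - 1 - j) :=
              mul_le_mul (pow_le_pow_left₀ hp (hpq.trans hqr) j) (pow_le_pow_left₀ hq hqr _)
                (by positivity) (by positivity)
          _ = r ^ (m - 1) := by
              rw [← pow_add]
              congr 1
              omega
    _ = _ := by simp

section HazardCdf

variable {k : ℝ → ℝ}

lemma hasDerivAt_hazCdf (hk : Continuous k) (x : ℝ) :
    HasDerivAt (hazCdf k) ((1 - hazCdf k x) * k x) x := by
  have h := ((hk.integral_hasStrictDerivAt 0 x).hasDerivAt.neg.exp).const_sub 1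
  refine h.congr_deriv ?_
  simp only [hazCdf, Pi.neg_apply]
  ring

lemma hazCdf_lt_one (k : ℝ → ℝ) (x : ℝ) : hazCdf k x < 1 := by
  have := Real.exp_pos (-(∫ u in (0 : ℝ)..x, k u))
  simp only [hazCdf]
  linarith

lemma monotone_hazCdf (hk : Continuous k) (hk0 : ∀ x, 0 ≤ k x) : Monotone (hazCdf k) :=
  monotone_of_deriv_nonneg (fun x => (hasDerivAt_hazCdf hk x).differentiableAt) fun x => by
    rw [(hasDerivAt_hazCdf hk x).deriv]
    exact mul_nonneg (by linarith [hazCdf_lt_one k x]) (hk0 x)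

lemma hazCdf_nonneg (hk : Continuous k) (hk0 : ∀ x, 0 ≤ k x) {x : ℝ} (hx : 0 ≤ x) :
    0 ≤ hazCdf k x := by
  have h := monotone_hazCdf hk hk0 hx
  simpa [hazCdf] using h

lemma integrableOn_hazCdf_pow (hk : Continuous k) (hk0 : ∀ x, 0 ≤ k x) {y : ℝ} (hy : 0 ≤ y)
    (i : ℕ) :
    IntegrableOn (fun z => hazCdf k z ^ i * ((1 - hazCdf k z) * k z)) (Ici y) ∧
      ∫ z in Ici y, hazCdf k z ^ i * ((1 - hazCdf k z) * k z) ≤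
        (1 - hazCdf k y ^ (i + 1)) / (i + 1) := by
  have hpos : (0 : ℝ) < i + 1 := by positivity
  have hmono := monotone_hazCdf hk hk0
  have hderiv : ∀ z, HasDerivAt (fun z => hazCdf k z ^ (i + 1) / ((i : ℝ) + 1))
      (hazCdf k z ^ i * ((1 - hazCdf k z) * k z)) z := fun z => by
    refine (((hasDerivAt_hazCdf hk z).pow (i + 1)).div_const ((i : ℝ) + 1)).congr_deriv ?_
    push_cast
    field_simp
  have hnonneg : ∀ z ∈ Ioi y, 0 ≤ hazCdf k z ^ i * ((1 - hazCdf k z) * k z) := fun z hz =>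
    mul_nonneg (pow_nonneg (hazCdf_nonneg hk hk0 (hy.trans (le_of_lt hz))) i)
      (mul_nonneg (by linarith [hazCdf_lt_one k z]) (hk0 z))
  have hbdd : BddAbove (range (hazCdf k)) := ⟨1, by
    rintro _ ⟨z, rfl⟩
    exact (hazCdf_lt_one k z).le⟩
  have hlim := ((tendsto_atTop_ciSup hmono hbdd).pow (i + 1)).div_const ((i : ℝ) + 1)
  have hsup0 : 0 ≤ ⨆ z, hazCdf k z := (hazCdf_nonneg hk hk0 hy).trans (le_ciSup hbdd y)
  have hsup1 : ⨆ z, hazCdf k z ≤ 1 := ciSup_le fun z => (hazCdf_lt_one k z).le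
  refine ⟨(integrableOn_Ici_iff_integrableOn_Ioi).2
    (integrableOn_Ioi_deriv_of_nonneg' (fun z _ => hderiv z) hnonneg hlim), ?_⟩
  rw [integral_Ici_eq_integral_Ioi,
    integral_Ioi_of_hasDerivAt_of_nonneg' (fun z _ => hderiv z) hnonneg hlim, ← sub_div]
  gcongr
  exact pow_le_one₀ hsup0 hsup1

/-- For a density `f` that is dominated by the survival function wherever the cdf exceeds `r`,
the inner integral of the covariance term is `O(1)` uniformly in the first variable. -/
lemma abs_nat_mul_integral_covBracket_le (hk : Continuous k) (hk0 : ∀ x, 0 ≤ k x) {M : ℝ}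
    (hkM : ∀ x, k x ≤ M) {S : Set ℝ} (hS : MeasurableSet S) {f : ℝ → ℝ}
    (hf0 : ∀ z, 0 ≤ f z) (hf : IntegrableOn f S) (hf1 : ∫ z in S, f z = 1) {r C : ℝ}
    (hr : 0 ≤ r) (hC : 0 ≤ C)
    (htail : ∀ z ∈ S, hazCdf k z ≤ r ∨ f z ≤ C * (1 - hazCdf k z)) {y : ℝ} (hy : 0 ≤ y)
    (m : ℕ) :
    |m * ∫ z in S ∩ Ici y,
      (hazCdf k z ^ m * (1 - hazCdf k y ^ m) -
        (1 - hazCdf k y) / (hazCdf k z - hazCdf k y) * (hazCdf k z ^ m - hazCdf k y ^ m)) *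
        f y * f z * k y * k z| ≤
      f y * (M * (M * (m ^ 2 * r ^ (m - 1)) + 2 * C)) := by
  have hM : 0 ≤ M := (hk0 0).trans (hkM 0)
  set p := hazCdf k y with hp_def
  have hp0 : 0 ≤ p := hazCdf_nonneg hk hk0 hy
  have hp1 : p ≤ 1 := (hazCdf_lt_one k y).le
  have hp1' : 0 ≤ 1 - p := by linarith
  set Φ : ℝ → ℝ := fun z => ∑ j ∈ Finset.range m,
    p ^ j * (hazCdf k z ^ (m - 1 - j) * ((1 - hazCdf k z) * k z)) with hΦ
  have hT : ∀ j : ℕ, IntegrableOn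
      (fun z => p ^ j * (hazCdf k z ^ (m - 1 - j) * ((1 - hazCdf k z) * k z))) (Ici y) :=
    fun j => (integrableOn_hazCdf_pow hk hk0 hy _).1.const_mul _
  have hΦ_int : IntegrableOn Φ (Ici y) := integrable_finsetSum _ fun j _ => hT j
  have hF0 : ∀ z ∈ Ici y, 0 ≤ hazCdf k z := fun z hz => hazCdf_nonneg hk hk0 (hy.trans hz)
  have hΦ0 : ∀ z ∈ Ici y, 0 ≤ Φ z := fun z hz => Finset.sum_nonneg fun j _ =>
    mul_nonneg (pow_nonneg hp0 j) (mul_nonneg (pow_nonneg (hF0 z hz) _)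
      (mul_nonneg (by linarith [hazCdf_lt_one k z]) (hk0 z)))
  have hΦ_le : ∫ z in Ici y, Φ z ≤ ∑ j ∈ Finset.range m,
      p ^ j * ((1 - p ^ (m - 1 - j + 1)) / ((m - 1 - j : ℕ) + 1)) := by
    rw [hΦ, integral_finsetSum _ fun j _ => hT j]
    refine Finset.sum_le_sum fun j _ => ?_
    rw [integral_const_mul]
    exact mul_le_mul_of_nonneg_left (integrableOn_hazCdf_pow hk hk0 hy _).2 (pow_nonneg hp0 j)
  have hΦS : ∫ z in S ∩ Ici y, Φ z ≤ ∫ z in Ici y, Φ z :=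
    setIntegral_mono_set hΦ_int ((ae_restrict_iff' measurableSet_Ici).2 (ae_of_all _ hΦ0))
      (ae_of_all _ fun z hz => hz.2)
  have hfS : ∫ z in S ∩ Ici y, f z ≤ 1 := hf1 ▸
    setIntegral_mono_set hf (ae_of_all _ hf0) (ae_of_all _ fun z hz => hz.1)
  set A : ℝ := M * (m * r ^ (m - 1)) with hA
  have hA0 : 0 ≤ A := by positivity
  have hint : IntegrableOn (fun z => f y * k y * (A * f z + C * (1 - p) * Φ z))
      (S ∩ Ici y) :=
    (((hf.mono_set inter_subset_left).const_mul A).add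
      ((hΦ_int.mono_set inter_subset_right).const_mul (C * (1 - p)))).const_mul _
  have hpt : ∀ z ∈ S ∩ Ici y,
      ‖(hazCdf k z ^ m * (1 - p ^ m) -
        (1 - p) / (hazCdf k z - p) * (hazCdf k z ^ m - p ^ m)) * f y * f z * k y * k z‖ ≤
      f y * k y * (A * f z + C * (1 - p) * Φ z) := by
    rintro z ⟨hzS, hzy⟩
    have hpq : p ≤ hazCdf k z := monotone_hazCdf hk hk0 hzy
    have hB := abs_covBracket_le hp0 hpq (hazCdf_lt_one k z).le m
    set B := hazCdf k z ^ m * (1 - p ^ m) -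
      (1 - p) / (hazCdf k z - p) * (hazCdf k z ^ m - p ^ m)
    set Q := ∑ j ∈ Finset.range m, p ^ j * hazCdf k z ^ (m - 1 - j) with hQ
    have hQ0 : 0 ≤ Q := Finset.sum_nonneg fun j _ =>
      mul_nonneg (pow_nonneg hp0 j) (pow_nonneg (hp0.trans hpq) _)
    have hΦQ : Φ z = Q * ((1 - hazCdf k z) * k z) := by
      rw [hQ, Finset.sum_mul]
      exact Finset.sum_congr rfl fun j _ => by ring
    have hnorm : ‖B * f y * f z * k y * k z‖ = f y * k y * (|B| * (f z * k z)) := by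
      simp only [Real.norm_eq_abs, abs_mul, abs_of_nonneg (hf0 _), abs_of_nonneg (hk0 _)]
      ring
    rw [hnorm]
    refine mul_le_mul_of_nonneg_left ?_ (mul_nonneg (hf0 y) (hk0 y))
    have hfk : 0 ≤ f z * k z := mul_nonneg (hf0 z) (hk0 z)
    have hrest : 0 ≤ C * (1 - p) * Φ z := mul_nonneg (mul_nonneg hC hp1') (hΦ0 z hzy)
    rcases htail z hzS with hz | hz
    · have hBr : |B| ≤ m * r ^ (m - 1) :=
        hB.trans ((mul_le_of_le_one_left hQ0 (by linarith)).trans (sum_mixed_pow_le hp0 hpq hz m))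
      calc |B| * (f z * k z) ≤ (m * r ^ (m - 1)) * (f z * M) :=
            mul_le_mul hBr (mul_le_mul_of_nonneg_left (hkM z) (hf0 z)) hfk (by positivity)
        _ = A * f z := by rw [hA]; ring
        _ ≤ _ := by linarith
    · calc |B| * (f z * k z) ≤ ((1 - p) * Q) * (C * (1 - hazCdf k z) * k z) :=
            mul_le_mul hB (mul_le_mul_of_nonneg_right hz (hk0 z)) hfk (mul_nonneg hp1' hQ0)
        _ = C * (1 - p) * Φ z := by rw [hΦQ]; ring
        _ ≤ _ := by linarith [mul_nonneg hA0 (hf0 z)]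
  have hinner := norm_integral_le_of_norm_le hint
    ((ae_restrict_iff' (hS.inter measurableSet_Ici)).2 (ae_of_all _ hpt))
  rw [integral_const_mul, integral_add ((hf.mono_set inter_subset_left).const_mul A)
      ((hΦ_int.mono_set inter_subset_right).const_mul (C * (1 - p))),
    integral_const_mul, integral_const_mul, Real.norm_eq_abs] at hinner
  have hweight := nat_mul_weighted_geom_sum_le hp0 hp1 m
  set W := ∑ j ∈ Finset.range m, p ^ j * ((1 - p ^ (m - 1 - j + 1)) / ((m - 1 - j : ℕ) + 1))
  have hbound : A * (∫ z in S ∩ Ici y, f z) + C * (1 - p) * (∫ z in S ∩ Ici y, Φ z) ≤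
      A + C * (1 - p) * W :=
    add_le_add (mul_le_of_le_one_right hA0 hfS)
      (mul_le_mul_of_nonneg_left (hΦS.trans hΦ_le) (mul_nonneg hC hp1'))
  rw [abs_mul, Nat.abs_cast]
  calc _ ≤ (m : ℝ) * (f y * k y * (A + C * (1 - p) * W)) :=
        mul_le_mul_of_nonneg_left (hinner.trans
          (mul_le_mul_of_nonneg_left hbound (mul_nonneg (hf0 y) (hk0 y)))) (by positivity)
    _ = f y * (k y * (M * (m ^ 2 * r ^ (m - 1)) + C * (m * ((1 - p) * W)))) := by
        rw [hA]; ring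
    _ ≤ f y * (k y * (M * (m ^ 2 * r ^ (m - 1)) + C * 2)) := by
        refine mul_le_mul_of_nonneg_left (mul_le_mul_of_nonneg_left ?_ (hk0 y)) (hf0 y)
        exact add_le_add le_rfl (mul_le_mul_of_nonneg_left hweight hC)
    _ ≤ f y * (M * (M * (m ^ 2 * r ^ (m - 1)) + 2 * C)) := by
        rw [mul_comm C 2]
        refine mul_le_mul_of_nonneg_left (mul_le_mul_of_nonneg_right (hkM y) ?_) (hf0 y)
        positivity

end HazardCdf

lemma tendsto_sq_mul_pow_pred {r : ℝ} (hr0 : 0 < r) (hr1 : r < 1) :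
    Tendsto (fun m : ℕ => (m : ℝ) ^ 2 * r ^ (m - 1)) atTop (𝓝 0) := by
  have h := (tendsto_pow_const_mul_const_pow_of_abs_lt_one 2
    (by rwa [abs_of_pos hr0] : |r| < 1)).div_const r
  rw [zero_div] at h
  refine h.congr fun m => ?_
  rcases m with _ | n
  · simp
  · rw [Nat.add_sub_cancel, pow_succ r n]
    field_simp

/-- The off-diagonal covariance term of the variance of the hazard estimator is negligible:
under Assumptions 3, 5 and 6, with `b_m → 0`, writing `F = hazCdf k` and
`α_b(t) = ∫_S κ_{t,b}(y)² dy`,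
`(m/α_{b_m}(t)) ∬_{y ≤ z} (F(z)^m (1−F(y)^m) − ((1−F(y))/(F(z)−F(y)))(F(z)^m−F(y)^m))
  κ_{t,b_m}(y) κ_{t,b_m}(z) k(y) k(z) dy dz → 0`. -/
theorem offdiagonal_term_negligible
    (γ : ℝ) (hγ : 0 < γ)
    (S : Set ℝ) (hS_meas : MeasurableSet S) (hS_sub : S ⊆ Ici 0)
    (κ : ℝ → ℝ → ℝ → ℝ)
    (hκ_nonneg : ∀ t ∈ S, ∀ b : ℝ, 0 < b → ∀ y, 0 ≤ κ t b y)
    (hκ_density : ∀ t ∈ S, ∀ b : ℝ, 0 < b → (∫ y in S, κ t b y) = 1)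
    (hκ_mean : ∀ t ∈ S, Tendsto (fun b => lamK S κ t b) (𝓝[>] (0 : ℝ)) (𝓝 0))
    (hκ_var : ∀ t ∈ S, Tendsto (fun b => varK S κ t b) (𝓝[>] (0 : ℝ)) (𝓝 0))
    -- the hazard rate: bounded and continuous
    (k : ℝ → ℝ) (hk_cont : Continuous k) (hk_nonneg : ∀ x, 0 ≤ k x)
    (Mk : ℝ) (hk_bdd : ∀ x, |k x| ≤ Mk)
    -- Assumption 3 (compatibility)
    (lambda : ℝ) (hlambda : 0 < lambda) (b₀ G : ℝ → ℝ)
    (hA3 : ∀ t ∈ S, 0 < b₀ t ∧ 0 < G t ∧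
      ∀ b : ℝ, 0 < b → b ≤ b₀ t → ∀ y ∈ S, lambda < |y - t| →
        κ t b y / (1 - hazCdf k y) < G t)
    -- Assumption 5
    (hA5 : ∀ b : ℝ, 0 < b → ∀ J : Set ℝ, IsCompact J →
      Integrable (fun y => ⨆ t : J, κ (t : ℝ) b y) (volume.restrict S) ∧
      Integrable (fun y => ⨆ t : J, (κ (t : ℝ) b y) ^ 2) (volume.restrict S))
    -- Assumption 6
    (C₃ C₄ : ℝ → ℝ) (hC₃_pos : ∀ t, 0 < C₃ t) (hC₄_pos : ∀ t, 0 < C₄ t)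
    (hC₃_loc : ∀ K : Set ℝ, IsCompact K → BddAbove (C₃ '' K))
    (hC₄_loc : ∀ K : Set ℝ, IsCompact K → BddAbove (C₄ '' K))
    (hA6 : ∀ t ∈ S, ∀ b : ℝ, 0 < b → b ≤ 1 →
      C₃ t * b ^ (-γ) ≤ (∫ y in S, κ t b y ^ 2) ∧
      C₄ t * b ^ (-(2 * γ)) ≤ (∫ y in S, κ t b y ^ 3))
    -- bandwidths
    (b : ℕ → ℝ) (hb_pos : ∀ m, 0 < b m) (hb_lim : Tendsto b atTop (𝓝 0))
    (t : ℝ) (ht : t ∈ S) :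
    Tendsto
      (fun m : ℕ =>
        ((m : ℝ) / ∫ y in S, κ t (b m) y ^ 2) *
          ∫ y in S, (∫ z in S ∩ Ici y,
            (hazCdf k z ^ m * (1 - hazCdf k y ^ m) -
                (1 - hazCdf k y) / (hazCdf k z - hazCdf k y) *
                  (hazCdf k z ^ m - hazCdf k y ^ m)) *
              κ t (b m) y * κ t (b m) z * k y * k z))
      atTop (𝓝 0) := by
  obtain ⟨hb₀, hG, htail⟩ := hA3 t ht
  have hkM : ∀ x, k x ≤ Mk := fun x => (le_abs_self _).trans (hk_bdd x)
  have hb_lim' : Tendsto b atTop (𝓝[>] 0) :=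
    tendsto_nhdsWithin_iff.2 ⟨hb_lim, Eventually.of_forall hb_pos⟩
  obtain ⟨r, hr, hr1⟩ := exists_between
    (max_lt (hazCdf_lt_one k (t + lambda)) (zero_lt_one (α := ℝ)))
  have hr0 : 0 < r := (le_max_right _ _).trans_lt hr
  have hb_small : ∀ᶠ m in atTop, b m ≤ b₀ t ∧ b m ≤ 1 :=
    (hb_lim.eventually_le_const hb₀).and (hb_lim.eventually_le_const one_pos)
  have hα_top : Tendsto (fun m => ∫ y in S, κ t (b m) y ^ 2) atTop atTop := by
    have h : Tendsto (fun m => C₃ t * b m ^ (-γ)) atTop atTop :=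
      ((tendsto_rpow_neg_nhdsGT_zero (neg_neg_of_pos hγ)).comp hb_lim').const_mul_atTop (hC₃_pos t)
    refine tendsto_atTop_mono' _ ?_ h
    filter_upwards [hb_small] with m hm
    exact (hA6 t ht (b m) (hb_pos m) hm.2).1
  have hnum : Tendsto
      (fun m : ℕ => Mk * (Mk * ((m : ℝ) ^ 2 * r ^ (m - 1)) + 2 * G t)) atTop
      (𝓝 (Mk * (Mk * 0 + 2 * G t))) :=
    (((tendsto_sq_mul_pow_pred hr0 hr1).const_mul Mk).add_const _).const_mul Mk
  refine squeeze_zero_norm' ?_ (hnum.div_atTop hα_top)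
  filter_upwards [hb_small, hα_top.eventually_gt_atTop 0] with m hm hα
  have hκ1 := hκ_density t ht (b m) (hb_pos m)
  have hκ_int : IntegrableOn (κ t (b m)) S := by
    by_contra h
    rw [integral_undef h] at hκ1
    exact zero_ne_one hκ1
  have hdich : ∀ z ∈ S, hazCdf k z ≤ r ∨ κ t (b m) z ≤ G t * (1 - hazCdf k z) := by
    intro z hz
    rcases le_or_gt |z - t| lambda with h | h
    · left
      refine (monotone_hazCdf hk_cont hk_nonneg (?_ : z ≤ t + lambda)).trans
        ((le_max_left _ _).trans hr.le)
      linarith [(abs_le.1 h).2]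
    · right
      exact ((div_lt_iff₀ (sub_pos.2 (hazCdf_lt_one k z))).1
        (htail (b m) (hb_pos m) hm.1 z hz h)).le
  rw [div_mul_eq_mul_div, norm_div, Real.norm_of_nonneg hα.le, ← integral_const_mul]
  refine div_le_div_of_nonneg_right ?_ hα.le
  refine (norm_integral_le_of_norm_le (hκ_int.mul_const _)
    ((ae_restrict_iff' hS_meas).2 (ae_of_all _ fun y hy =>
      abs_nat_mul_integral_covBracket_le hk_cont hk_nonneg hkM hS_meas
        (hκ_nonneg t ht (b m) (hb_pos m)) hκ_int hκ1 hr0.le hG.le hdich (hS_sub hy) m))).trans_eq ?_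
  rw [integral_mul_const, hκ1, one_mul]
end
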